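/- arXiv:2306.15846 — 3 statements merged into one kernel-verified Lean document; each statement's English description precedes it below -/
import Mathlib

section
/- Let v₁, v₂, dn, d'n ∈ (Fin 3 → ℝ) and k₁, β₁, β₂, t ∈ ℝ, with dn = -k₁·v₁ and d'n = β₁·v₁ + β₂·v₂. Then the cross product of the tangent vectors of the parallel surface satisfies (v₁ + t·dn) × (v₂ + t·d'n) = (1 - t·k₁)·(1 + t·β₂) · (v₁ × v₂). In particular, if (1 - t·k₁)(1 + t·β₂) > 0 and v₁ × v₂ ≠ 0, the unit normal is unchanged: (v₁ + t·dn) × (v₂ + t·d'n) normalized equals (v₁ × v₂) normalized. -/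
open Matrix

/-- Parallel surfaces keep the unit normal: with `dn = -k₁ v₁` and
`d'n = β₁ v₁ + β₂ v₂`, the cross product of the tangent vectors of the parallel
surface is `(1 - t k₁)(1 + t β₂)` times `v₁ ×₃ v₂`; if this factor is positive and
`v₁ ×₃ v₂ ≠ 0`, the normalized cross products agree. -/
theorem stmt11 (v₁ v₂ dn d'n : Fin 3 → ℝ) (k₁ β₁ β₂ t : ℝ)
    (hdn : dn = (-k₁) • v₁) (hd'n : d'n = β₁ • v₁ + β₂ • v₂) :
    crossProduct (v₁ + t • dn) (v₂ + t • d'n)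
      = ((1 - t * k₁) * (1 + t * β₂)) • crossProduct v₁ v₂ ∧
    ((1 - t * k₁) * (1 + t * β₂) > 0 → crossProduct v₁ v₂ ≠ 0 →
      ‖crossProduct (v₁ + t • dn) (v₂ + t • d'n)‖⁻¹ •
          crossProduct (v₁ + t • dn) (v₂ + t • d'n)
        = ‖crossProduct v₁ v₂‖⁻¹ • crossProduct v₁ v₂) := by
  have h : crossProduct (v₁ + t • dn) (v₂ + t • d'n)
      = ((1 - t * k₁) * (1 + t * β₂)) • crossProduct v₁ v₂ := by
    subst hdn hd'n
    simp only [map_add, map_smul, LinearMap.add_apply, LinearMap.smul_apply, cross_self]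
    module
  refine ⟨h, fun hpos _ => ?_⟩
  rw [h, norm_smul, Real.norm_of_nonneg hpos.le, smul_smul, _root_.mul_inv_rev, mul_assoc,
    inv_mul_cancel₀ hpos.ne', mul_one]
end

section
/- Let r > 0, h ≠ 0 and θ ∈ ℝ with sin θ ≠ 0. Define the points p₀ := (r, 0, 0), p₁ := (r·cos θ, r·sin θ, h), p₂ := (r·cos θ, -r·sin θ, -h), p₃ := (r·cos θ, -r·sin θ, h) in ℝ³, and the unit vectors n₀ := (1,0,0), n₁ := (cos θ, sin θ, 0), n₂ = n₃ := (cos θ, -sin θ, 0). Then: (i) all four points lie on the cylinder x² + y² = r²; (ii) the three bond lengths are equal: ‖p₀ - p₁‖² = ‖p₀ - p₂‖² = ‖p₀ - p₃‖² = 2r²(1 - cos θ) + h²; (iii) with v₁ := p₁ - p₃ = (0, 2r·sin θ, 0) and v₂ := p₂ - p₃ = (0, 0, -2h), one has n₁ - n₃ = (1/r)·v₁ and n₂ - n₃ = 0, i.e., v₁ is a discrete principal direction with curvature k₁ = -1/r and v₂ is a discrete principal direction with curvature k₂ = 0; (iv) the cross product v₁ × v₂ is a nonzero scalar multiple of n₀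 = (1,0,0), so the unit normal of the tangent plane at p₀ is ±(1,0,0). -/
/-- Fundamental piece of the chiral-type discrete round cylinder: the four vertices lie
on the cylinder of radius `r`, the three bond lengths are equal, `v₁` and `v₂` are discrete
principal directions with curvatures `k₁ = -1/r` and `k₂ = 0`, and the cross product
`v₁ × v₂` is a nonzero multiple of `(1,0,0)`. -/
theorem stmt14 (r h θ : ℝ) (hr : 0 < r) (hh : h ≠ 0) (hθ : Real.sin θ ≠ 0) :
    let p₀ : EuclideanSpace ℝ (Fin 3) := (WithLp.equiv 2 (Fin 3 → ℝ)).symm ![r, 0, 0]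
    let p₁ : EuclideanSpace ℝ (Fin 3) :=
      (WithLp.equiv 2 (Fin 3 → ℝ)).symm ![r * Real.cos θ, r * Real.sin θ, h]
    let p₂ : EuclideanSpace ℝ (Fin 3) :=
      (WithLp.equiv 2 (Fin 3 → ℝ)).symm ![r * Real.cos θ, -(r * Real.sin θ), -h]
    let p₃ : EuclideanSpace ℝ (Fin 3) :=
      (WithLp.equiv 2 (Fin 3 → ℝ)).symm ![r * Real.cos θ, -(r * Real.sin θ), h]
    let n₁ : EuclideanSpace ℝ (Fin 3) :=
      (WithLp.equiv 2 (Fin 3 → ℝ)).symm ![Real.cos θ, Real.sin θ, 0]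
    let n₂ : EuclideanSpace ℝ (Fin 3) :=
      (WithLp.equiv 2 (Fin 3 → ℝ)).symm ![Real.cos θ, -Real.sin θ, 0]
    let n₃ : EuclideanSpace ℝ (Fin 3) :=
      (WithLp.equiv 2 (Fin 3 → ℝ)).symm ![Real.cos θ, -Real.sin θ, 0]
    let v₁ : EuclideanSpace ℝ (Fin 3) := p₁ - p₃
    let v₂ : EuclideanSpace ℝ (Fin 3) := p₂ - p₃
    -- (i) all four points lie on the cylinder x² + y² = r²
    ((p₀ 0) ^ 2 + (p₀ 1) ^ 2 = r ^ 2 ∧ (p₁ 0) ^ 2 + (p₁ 1) ^ 2 = r ^ 2 ∧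
      (p₂ 0) ^ 2 + (p₂ 1) ^ 2 = r ^ 2 ∧ (p₃ 0) ^ 2 + (p₃ 1) ^ 2 = r ^ 2) ∧
    -- (ii) the three bond lengths are equal
    (‖p₀ - p₁‖ ^ 2 = 2 * r ^ 2 * (1 - Real.cos θ) + h ^ 2 ∧
      ‖p₀ - p₂‖ ^ 2 = 2 * r ^ 2 * (1 - Real.cos θ) + h ^ 2 ∧
      ‖p₀ - p₃‖ ^ 2 = 2 * r ^ 2 * (1 - Real.cos θ) + h ^ 2) ∧
    -- (iii) discrete principal directions with k₁ = -1/r and k₂ = 0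
    (v₁ = (WithLp.equiv 2 (Fin 3 → ℝ)).symm ![0, 2 * r * Real.sin θ, 0] ∧
      v₂ = (WithLp.equiv 2 (Fin 3 → ℝ)).symm ![0, 0, -(2 * h)] ∧
      n₁ - n₃ = (-(-(1 / r))) • v₁ ∧ n₂ - n₃ = (-(0 : ℝ)) • v₂) ∧
    -- (iv) v₁ × v₂ is a nonzero scalar multiple of (1,0,0)
    (∃ c : ℝ, c ≠ 0 ∧ crossProduct v₁ v₂ = c • ![1, 0, 0]) := by
  intro p₀ p₁ p₂ p₃ n₁ n₂ n₃ v₁ v₂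
  have hsc := Real.sin_sq_add_cos_sq θ
  have hv₁ : v₁ = (WithLp.equiv 2 (Fin 3 → ℝ)).symm ![0, 2 * r * Real.sin θ, 0] := by
    ext i
    fin_cases i <;> simp [v₁, p₁, p₃]
    ring
  have hv₂ : v₂ = (WithLp.equiv 2 (Fin 3 → ℝ)).symm ![0, 0, -(2 * h)] := by
    ext i
    fin_cases i <;> simp [v₂, p₂, p₃]
    ring
  refine ⟨⟨?_, ?_, ?_, ?_⟩, ⟨?_, ?_, ?_⟩, ⟨hv₁, hv₂, ?_, ?_⟩,
    ⟨-(4 * r * h * Real.sin θ), ?_, ?_⟩⟩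
  · simp [p₀]
  · simp [p₁]
    linear_combination r ^ 2 * hsc
  · simp [p₂]
    linear_combination r ^ 2 * hsc
  · simp [p₃]
    linear_combination r ^ 2 * hsc
  · simp [EuclideanSpace.real_norm_sq_eq, Fin.sum_univ_three, p₀, p₁]
    linear_combination r ^ 2 * hsc
  · simp [EuclideanSpace.real_norm_sq_eq, Fin.sum_univ_three, p₀, p₂]
    linear_combination r ^ 2 * hsc
  · simp [EuclideanSpace.real_norm_sq_eq, Fin.sum_univ_three, p₀, p₃]
    linear_combination r ^ 2 * hsc
  · rw [hv₁]
    ext i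
    fin_cases i <;> simp [n₁, n₃]
    field_simp
    ring
  · simp [n₂, n₃]
  · simp [hr.ne', hh, hθ]
  · rw [hv₁, hv₂, cross_apply]
    ext i
    fin_cases i <;> simp
    ring
end

section
/- Let r₁, r₂ > 0 and define f(u,v) := ((r₁·cos u + r₂)·cos v, (r₁·cos u + r₂)·sin v, r₁·sin u) and ν(u,v) := (cos u·cos v, cos u·sin v, sin u) in ℝ³. Let p₁, p₂, q₁, q₂ ∈ ℝ with sin((q₁ - q₂)/2) ≠ 0 and (p₁ + p₂)/2 ∈ (-π/2, π/2), and set q₀ := (q₁ + q₂)/2 and p₀ := arctan( tan((p₁ + p₂)/2) · cos((q₁ - q₂)/2) ). Define v₁ := f(p₁, q₁) - f(p₁, q₂) and v₂ := f(p₁, q₁) - f(p₂, q₁). Then there exists λ ∈ ℝ such that the cross product satisfies v₁ × v₂ = λ · ν(p₀, q₀); i.e., the discrete tangent plane at the torus vertex f(p₀, q₀) with adjacent vertices f(p₁,q₁), f(p₁,q₂), f(p₂,q₁) has its normal parallel to the smooth unit normal ν(p₀,q₀) of the torus. -/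
/-- Key computation for the discrete CPC torus: with the torus `f` and its unit normal `ν`,
vertices `f(p₁,q₁), f(p₁,q₂), f(p₂,q₁)` adjacent to `f(p₀,q₀)` where `q₀ = (q₁+q₂)/2` and
`p₀ = arctan(tan((p₁+p₂)/2)·cos((q₁-q₂)/2))`, the cross product of the tangent vectors is
parallel to the smooth unit normal `ν(p₀,q₀)`. -/
theorem stmt15 (r₁ r₂ : ℝ) (hr₁ : 0 < r₁) (hr₂ : 0 < r₂) (p₁ p₂ q₁ q₂ : ℝ)
    (hq : Real.sin ((q₁ - q₂) / 2) ≠ 0)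
    (hp : (p₁ + p₂) / 2 ∈ Set.Ioo (-(Real.pi / 2)) (Real.pi / 2)) :
    let f : ℝ → ℝ → Fin 3 → ℝ := fun u v =>
      ![(r₁ * Real.cos u + r₂) * Real.cos v, (r₁ * Real.cos u + r₂) * Real.sin v,
        r₁ * Real.sin u]
    let ν : ℝ → ℝ → Fin 3 → ℝ := fun u v =>
      ![Real.cos u * Real.cos v, Real.cos u * Real.sin v, Real.sin u]
    let q₀ : ℝ := (q₁ + q₂) / 2
    let p₀ : ℝ := Real.arctan (Real.tan ((p₁ + p₂) / 2) * Real.cos ((q₁ - q₂) / 2))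
    let v₁ : Fin 3 → ℝ := f p₁ q₁ - f p₁ q₂
    let v₂ : Fin 3 → ℝ := f p₁ q₁ - f p₂ q₁
    ∃ lam : ℝ, crossProduct v₁ v₂ = lam • ν p₀ q₀ := by
  intro f ν q₀ p₀ v₁ v₂
  obtain ⟨P, hP⟩ : ∃ P, P = (p₁ + p₂) / 2 := ⟨_, rfl⟩
  obtain ⟨e, he⟩ : ∃ e, e = (p₁ - p₂) / 2 := ⟨_, rfl⟩
  obtain ⟨d, hd⟩ : ∃ d, d = (q₁ - q₂) / 2 := ⟨_, rfl⟩
  obtain ⟨s, hs⟩ : ∃ s, s = (q₁ + q₂) / 2 := ⟨_, rfl⟩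
  have hcP : Real.cos P ≠ 0 := (Real.cos_pos_of_mem_Ioo (hP ▸ hp)).ne'
  have hc₀ : Real.cos p₀ ≠ 0 := (Real.cos_arctan_pos _).ne'
  have hq₀ : q₀ = s := hs.symm
  have hsin : Real.sin p₀ * Real.cos P = Real.sin P * Real.cos d * Real.cos p₀ := by
    have h : Real.tan p₀ = Real.tan P * Real.cos d := by
      simp only [p₀, Real.tan_arctan, hP, hd]
    rw [Real.tan_eq_sin_div_cos, Real.tan_eq_sin_div_cos] at h
    field_simp at h
    linear_combination h
  have hcos : Real.cos p₁ - Real.cos p₂ = -2 * Real.sin P * Real.sin e := by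
    rw [Real.cos_sub_cos, hP, he]
  have hsinp : Real.sin p₁ - Real.sin p₂ = 2 * Real.sin e * Real.cos P := by
    rw [Real.sin_sub_sin, hP, he]
  have hcosq : Real.cos q₁ - Real.cos q₂ = -2 * Real.sin s * Real.sin d := by
    rw [Real.cos_sub_cos, hs, hd]
  have hsinq : Real.sin q₁ - Real.sin q₂ = 2 * Real.sin d * Real.cos s := by
    rw [Real.sin_sub_sin, hs, hd]
  have hcd : Real.cos q₁ * Real.cos s + Real.sin q₁ * Real.sin s = Real.cos d := by
    rw [← Real.cos_sub, hs, hd]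
    ring_nf
  set R := r₁ * Real.cos p₁ + r₂
  have hv₁ : v₁ = ![-2 * R * Real.sin d * Real.sin s, 2 * R * Real.sin d * Real.cos s, 0] := by
    ext i
    fin_cases i <;> simp [v₁, f]
    · linear_combination R * hcosq
    · linear_combination R * hsinq
  have hv₂ : v₂ = ![-2 * r₁ * Real.sin e * Real.sin P * Real.cos q₁,
      -2 * r₁ * Real.sin e * Real.sin P * Real.sin q₁, 2 * r₁ * Real.sin e * Real.cos P] := by
    ext i
    fin_cases i <;> simp [v₂, f]
    · linear_combination r₁ * Real.cos q₁ * hcos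
    · linear_combination r₁ * Real.sin q₁ * hcos
    · linear_combination r₁ * hsinp
  refine ⟨4 * R * r₁ * Real.sin d * Real.sin e * Real.cos P / Real.cos p₀, ?_⟩
  rw [hv₁, hv₂, cross_apply, hq₀]
  ext i
  fin_cases i <;> simp [ν] <;> field_simp
  · ring
  · ring
  · linear_combination (4 * R * Real.sin d * Real.sin e) *
      (Real.sin P * Real.cos p₀ * hcd - hsin)
end
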